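/- arXiv:2209.05363 — 10 statements merged into one kernel-verified Lean document; each statement's English description precedes it below -/
import Mathlib

section
/- Lower bound of the mending-volume theorem for propagation problems (Theorem 3.6, lower bound): Let Δ ≥ 1 and m ≥ 1 be natural numbers, let μ : Fin m → Fin m → ℕ, let M be the matrix of μ, and let l₀ : Fin m. Suppose f : List (Fin Δ) → Option (Fin m) is a partial labeling of the infinite Δ-regular rooted tree such that (i) f [] = some l₀, and (ii) for every vertex v and every label l with f v = some l and every l' : Fin m, at least μ l l' of the children v ++ [i] (i : Fin Δ) satisfy f (v ++ [i]) = some l'. Then for every D : ℕ, the number of vertices v with v.length ≤ D and f v ≠ none is at least ∑_{d=0}^{D} ∑_{l' : Fin m} (M^d) l₀ l'. -/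
noncomputable def levelSet {Δ m : ℕ} (f : List (Fin Δ) → Option (Fin m)) (d : ℕ) (l : Fin m) :
    Finset (List (Fin Δ)) :=
  (List.finite_length_eq (Fin Δ) d).toFinset.filter (fun v => f v = some l)

lemma mem_levelSet {Δ m : ℕ} (f : List (Fin Δ) → Option (Fin m)) (d : ℕ) (l : Fin m)
    (v : List (Fin Δ)) : v ∈ levelSet f d l ↔ v.length = d ∧ f v = some l := by
  simp [levelSet]

lemma level_bound {Δ m : ℕ}
    (M : Matrix (Fin m) (Fin m) ℕ) (l₀ : Fin m)
    (f : List (Fin Δ) → Option (Fin m))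
    (hroot : f [] = some l₀)
    (hchild : ∀ (v : List (Fin Δ)) (l : Fin m), f v = some l →
      ∀ l' : Fin m,
        M l l' ≤ (Finset.univ.filter (fun i : Fin Δ => f (v ++ [i]) = some l')).card)
    (d : ℕ) : ∀ l' : Fin m, (M ^ d) l₀ l' ≤ (levelSet f d l').card := by
  induction d with
  | zero =>
    intro l'
    rw [pow_zero, Matrix.one_apply]
    split_ifs with h
    · apply Finset.card_pos.mpr
      exact ⟨[], by rw [mem_levelSet]; subst h; exact ⟨rfl, hroot⟩⟩
    · exact Nat.zero_le _
  | succ d ih =>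
    intro l'
    rw [pow_succ, Matrix.mul_apply]
    let T := (Finset.univ : Finset (Fin m)).sigma (fun l => (levelSet f d l).sigma
      (fun v => Finset.univ.filter (fun i : Fin Δ => f (v ++ [i]) = some l')))
    calc ∑ l, (M ^ d) l₀ l * M l l'
        ≤ ∑ l, ∑ v ∈ levelSet f d l,
            (Finset.univ.filter (fun i : Fin Δ => f (v ++ [i]) = some l')).card := by
          apply Finset.sum_le_sum
          intro l _
          calc (M ^ d) l₀ l * M l l' ≤ (levelSet f d l).card * M l l' :=
                Nat.mul_le_mul_right _ (ih l)
            _ ≤ _ := by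
                rw [← smul_eq_mul]
                apply Finset.card_nsmul_le_sum
                intro v hv
                exact hchild v l ((mem_levelSet f d l v).1 hv).2 l'
      _ = T.card := by simp only [T, Finset.card_sigma]
      _ ≤ (levelSet f (d + 1) l').card := by
          apply Finset.card_le_card_of_injOn (fun x => x.2.1 ++ [x.2.2])
          · rintro ⟨l, v, i⟩ hx
            simp only [T, Finset.coe_sigma, Set.mem_sigma_iff, Finset.mem_coe, Finset.mem_sigma,
              Finset.mem_filter, mem_levelSet] at hx ⊢
            simp_all
          · rintro ⟨l, v, i⟩ hx ⟨k, w, j⟩ hy h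
            simp only [T, Finset.mem_coe, Finset.mem_sigma,
              Finset.mem_filter, mem_levelSet] at hx hy
            have h' : v ++ [i] = w ++ [j] := h
            obtain ⟨rfl, h2⟩ := List.append_inj' h' rfl
            have h3 : i = j := by simpa using h2
            subst h3
            have h4 : l = k := by
              have := hx.2.1.2.symm.trans hy.2.1.2
              simpa using this
            subst h4
            rfl

/-- Lower bound of the mending-volume theorem for propagation problems
(Theorem 3.6, lower bound). -/
theorem propagation_mending_volume_lower_bound
    (Δ m : ℕ) (hΔ : 1 ≤ Δ) (hm : 1 ≤ m)
    (μ : Fin m → Fin m → ℕ)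
    (M : Matrix (Fin m) (Fin m) ℕ) (hM : ∀ l l', M l l' = μ l l')
    (l₀ : Fin m)
    (f : List (Fin Δ) → Option (Fin m))
    (hroot : f [] = some l₀)
    (hchild : ∀ (v : List (Fin Δ)) (l : Fin m), f v = some l →
      ∀ l' : Fin m,
        μ l l' ≤ (Finset.univ.filter (fun i : Fin Δ => f (v ++ [i]) = some l')).card)
    (D : ℕ) :
    (∑ d ∈ Finset.range (D + 1), ∑ l' : Fin m, (M ^ d) l₀ l') ≤
      {v : List (Fin Δ) | v.length ≤ D ∧ f v ≠ none}.ncard := by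
  have hc := level_bound M l₀ f hroot (by
    intro v l hv l'
    rw [hM]
    exact hchild v l hv l')
  let T := (Finset.range (D + 1)).sigma (fun d => (Finset.univ : Finset (Fin m)).sigma
    (fun l => levelSet f d l))
  have hfin : {v : List (Fin Δ) | v.length ≤ D ∧ f v ≠ none}.Finite :=
    (List.finite_length_le (Fin Δ) D).subset (fun v hv => hv.1)
  rw [Set.ncard_eq_toFinset_card _ hfin]
  calc _ ≤ ∑ d ∈ Finset.range (D + 1), ∑ l' : Fin m, (levelSet f d l').card :=
        Finset.sum_le_sum fun d _ => Finset.sum_le_sum fun l _ => hc d l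
    _ = T.card := by simp only [T, Finset.card_sigma]
    _ ≤ _ := by
        apply Finset.card_le_card_of_injOn (fun x => x.2.2)
        · rintro ⟨d, l, v⟩ hx
          simp only [T, Finset.mem_coe, Finset.mem_sigma, Finset.mem_range,
            mem_levelSet] at hx
          simp only [Set.Finite.coe_toFinset, Set.mem_setOf_eq]
          refine ⟨by omega, ?_⟩
          rw [hx.2.2.2]
          simp
        · rintro ⟨d, l, v⟩ hx ⟨e, k, w⟩ hy h
          simp only [T, Finset.mem_coe, Finset.mem_sigma, mem_levelSet] at hx hy
          have h' : v = w := h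
          subst h'
          have h1 : d = e := hx.2.2.1.symm.trans hy.2.2.1
          subst h1
          have h4 : l = k := by
            have := hx.2.2.2.symm.trans hy.2.2.2
            simpa using this
          subst h4
          rfl
end

section
/- Descendant-counting lemma for propagation constraints: Let Δ ≥ 1 and m ≥ 1 be natural numbers, let μ : Fin m → Fin m → ℕ, and let M be the matrix of μ. Suppose f : List (Fin Δ) → Fin m is a total labeling of the infinite Δ-regular rooted tree such that for every vertex v and every l' : Fin m, at least μ (f v) l' of the children v ++ [i] (i : Fin Δ) satisfy f (v ++ [i]) = l'. Then for every vertex v, every d : ℕ, and every l' : Fin m, the number of lists w : List (Fin Δ) with w.length = d and f (v ++ w) = l' is at least (M^d) (f v) l'. -/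
/-- Descendant-counting lemma for propagation constraints. -/
theorem propagation_descendant_count
    (Δ m : ℕ) (hΔ : 1 ≤ Δ) (hm : 1 ≤ m)
    (μ : Fin m → Fin m → ℕ)
    (M : Matrix (Fin m) (Fin m) ℕ) (hM : ∀ l l', M l l' = μ l l')
    (f : List (Fin Δ) → Fin m)
    (hchild : ∀ (v : List (Fin Δ)) (l' : Fin m),
      μ (f v) l' ≤ (Finset.univ.filter (fun i : Fin Δ => f (v ++ [i]) = l')).card)
    (v : List (Fin Δ)) (d : ℕ) (l' : Fin m) :
    (M ^ d) (f v) l' ≤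
      {w : List (Fin Δ) | w.length = d ∧ f (v ++ w) = l'}.ncard := by
  induction d generalizing v with
  | zero =>
    by_cases h : f v = l'
    · have : {w : List (Fin Δ) | w.length = 0 ∧ f (v ++ w) = l'} = {[]} := by
        ext w
        simp only [Set.mem_setOf_eq, Set.mem_singleton_iff, List.length_eq_zero_iff]
        constructor
        · exact fun hw => hw.1
        · rintro rfl
          simpa using h
      rw [this]
      simp [h]
    · simp [Matrix.one_apply, h]
  | succ d ih =>
    have hfin : ∀ (u : List (Fin Δ)) (n : ℕ),
        Finite {w : List (Fin Δ) | w.length = n ∧ f (u ++ w) = l'} := fun u n =>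
      ((List.finite_length_eq (Fin Δ) n).subset (fun w hw => hw.1)).to_subtype
    calc (M ^ (d + 1)) (f v) l' = ∑ l, M (f v) l * (M ^ d) l l' := by
          rw [pow_succ', Matrix.mul_apply]
      _ ≤ ∑ l, ∑ i ∈ Finset.univ.filter (fun i : Fin Δ => f (v ++ [i]) = l),
            (M ^ d) (f (v ++ [i])) l' := by
          refine Finset.sum_le_sum fun l _ => ?_
          rw [Finset.sum_congr rfl (g := fun _ => (M ^ d) l l')
            (fun i hi => by rw [(Finset.mem_filter.mp hi).2]), Finset.sum_const, smul_eq_mul, hM]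
          exact Nat.mul_le_mul_right _ (hchild v l)
      _ = ∑ i : Fin Δ, (M ^ d) (f (v ++ [i])) l' :=
          Finset.sum_fiberwise _ (fun i : Fin Δ => f (v ++ [i])) _
      _ ≤ ∑ i : Fin Δ, {w : List (Fin Δ) | w.length = d ∧ f ((v ++ [i]) ++ w) = l'}.ncard :=
          Finset.sum_le_sum fun i _ => ih (v ++ [i])
      _ = Nat.card (Σ i : Fin Δ,
            {w : List (Fin Δ) | w.length = d ∧ f ((v ++ [i]) ++ w) = l'}) := by
          have := fun i : Fin Δ => hfin (v ++ [i]) d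
          rw [Nat.card_sigma]
          rfl
      _ ≤ {w : List (Fin Δ) | w.length = d + 1 ∧ f (v ++ w) = l'}.ncard := by
          have := hfin v (d + 1)
          rw [← Nat.card_coe_set_eq]
          refine Nat.card_le_card_of_injective
            (fun p => ⟨p.1 :: p.2.1, by simpa using p.2.2⟩) ?_
          rintro ⟨i, w, hw⟩ ⟨j, w', hw'⟩ h
          simp only [Subtype.mk.injEq, List.cons.injEq] at h
          obtain ⟨rfl, rfl⟩ := h
          rfl
end

section
/- Landscape of the growth rate of matrix powers (Theorem 3.9, polynomial/exponential dichotomy): For every m ≥ 1 and every matrix M : Matrix (Fin m) (Fin m) ℕ, at least one of the following holds: (a) there exist constants C and p : ℕ such that for all d ≥ 1 and all indices l, l' : Fin m, (M^d) l l' ≤ C * d^p; or (b) there exists a real β > 0 such that the set of natural numbers d for which some entry of M^d satisfies (1 + β)^d ≤ (M^d) l l' (as real numbers) is infinite. -/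
theorem aux_expand_left {S : Type*} [Semiring S] (N R : S) (n : ℕ) :
    (N + R) ^ n = N ^ n + ∑ i ∈ Finset.range n, N ^ i * (R * (N + R) ^ (n - 1 - i)) := by
  induction n with
  | zero => simp
  | succ n ih =>
    rw [Finset.sum_range_succ']
    have h : ∀ i, n + 1 - 1 - (i + 1) = n - 1 - i := fun i => by omega
    simp only [h]
    rw [pow_succ' (N + R), add_mul]
    nth_rewrite 1 [ih]
    rw [mul_add, Finset.mul_sum]
    simp [pow_succ', mul_assoc, add_assoc]

theorem aux_expand_right {S : Type*} [Semiring S] (N R : S) (n : ℕ) :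
    (N + R) ^ n = N ^ n + ∑ i ∈ Finset.range n, (N + R) ^ (n - 1 - i) * (R * N ^ i) := by
  induction n with
  | zero => simp
  | succ n ih =>
    rw [Finset.sum_range_succ']
    have h : ∀ i, n + 1 - 1 - (i + 1) = n - 1 - i := fun i => by omega
    simp only [h]
    rw [pow_succ (N + R), mul_add]
    nth_rewrite 1 [ih]
    rw [add_mul, Finset.sum_mul]
    simp [pow_succ, mul_assoc, add_assoc]

theorem aux_pow_mono {m : ℕ} (N M : Matrix (Fin m) (Fin m) ℕ) (h : ∀ i j, N i j ≤ M i j)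
    (d : ℕ) : ∀ i j, (N ^ d) i j ≤ (M ^ d) i j := by
  induction d with
  | zero => intro i j; simp
  | succ d ih =>
    intro i j
    rw [pow_succ, pow_succ, Matrix.mul_apply, Matrix.mul_apply]
    exact Finset.sum_le_sum fun k _ => Nat.mul_le_mul (ih i k) (h k j)

theorem aux_poly {m : ℕ} (s : Finset (Fin m)) : ∀ M : Matrix (Fin m) (Fin m) ℕ,
    (∀ i, i ∉ s → ∀ j, M i j = 0) → (∀ d i, (M ^ d) i i ≤ 1) →
    ∃ C p : ℕ, ∀ d i j, (M ^ d) i j ≤ C * (d + 1) ^ p := by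
  induction s using Finset.induction_on with
  | empty =>
    intro M h0 _
    have hM : M = 0 := by ext i j; simp [h0 i (by simp) j]
    refine ⟨1, 0, fun d i j => ?_⟩
    subst hM
    rcases d with _ | d
    · simp only [pow_zero, Matrix.one_apply]; split_ifs <;> simp
    · simp
  | insert v s hv ih =>
    intro M h0 hd
    let N : Matrix (Fin m) (Fin m) ℕ := Matrix.of fun i j => if i = v then 0 else M i j
    let R : Matrix (Fin m) (Fin m) ℕ := Matrix.of fun i j => if i = v then M i j else 0
    have hNR : N + R = M := by
      ext i j
      simp only [N, R, Matrix.add_apply, Matrix.of_apply]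
      split_ifs <;> simp
    have hNM : ∀ i j, N i j ≤ M i j := by
      intro i j
      simp only [N, Matrix.of_apply]
      split_ifs <;> simp
    have hRX : ∀ (A X : Matrix (Fin m) (Fin m) ℕ) i j,
        (A * (R * X)) i j = A i v * (M * X) v j := by
      intro A X i j
      rw [Matrix.mul_apply, Finset.sum_eq_single v]
      · congr 1
        simp [Matrix.mul_apply, R]
      · intro b _ hb
        simp [Matrix.mul_apply, R, hb]
      · simp
    obtain ⟨C, p, hC⟩ := ih N (by
      intro i hi j
      simp only [N, Matrix.of_apply]
      split_ifs with h
      · rfl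
      · exact h0 i (by simp [h, hi]) j) (fun d i => (aux_pow_mono N M hNM d i i).trans (hd d i))
    have h1 : ∀ a l, (M ^ a) l v ≤ (a + 1) * (C * (a + 1) ^ p) := by
      intro a l
      have e := aux_expand_left N R a
      rw [hNR] at e
      rw [e, Matrix.add_apply, Matrix.sum_apply]
      have : ∑ i ∈ Finset.range a, (N ^ i * (R * M ^ (a - 1 - i))) l v
          ≤ ∑ i ∈ Finset.range a, C * (a + 1) ^ p := by
        refine Finset.sum_le_sum fun i hi => ?_
        rw [hRX, ← pow_succ']
        have hi' := Finset.mem_range.1 hi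
        calc (N ^ i) l v * (M ^ (a - 1 - i + 1)) v v ≤ (C * (i + 1) ^ p) * 1 :=
              Nat.mul_le_mul (hC _ _ _) (hd _ _)
          _ ≤ C * (a + 1) ^ p := by rw [mul_one]; gcongr
      rw [Finset.sum_const, Finset.card_range, smul_eq_mul] at this
      have := hC a l v
      linarith
    let K := ∑ j, M v j
    refine ⟨C + C * C * K, 2 * p + 2, fun d i j => ?_⟩
    have e := aux_expand_right N R d
    rw [hNR] at e
    rw [e, Matrix.add_apply, Matrix.sum_apply]
    have h2 : ∑ b ∈ Finset.range d, (M ^ (d - 1 - b) * (R * N ^ b)) i j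
          ≤ ∑ b ∈ Finset.range d, ((d + 1) * (C * (d + 1) ^ p)) * (K * (C * (d + 1) ^ p)) := by
      refine Finset.sum_le_sum fun b hb => ?_
      have hb' := Finset.mem_range.1 hb
      rw [hRX]
      refine Nat.mul_le_mul ((h1 _ _).trans ?_) ?_
      · have : d - 1 - b ≤ d := by omega
        gcongr
      · rw [Matrix.mul_apply, Finset.sum_mul]
        refine Finset.sum_le_sum fun k _ => Nat.mul_le_mul_left _ ((hC _ _ _).trans ?_)
        gcongr
    rw [Finset.sum_const, Finset.card_range, smul_eq_mul] at h2
    have h3 : C * (d + 1) ^ p ≤ C * (d + 1) ^ (2 * p + 2) := by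
      gcongr
      · omega
      · omega
    have h4 : d * (((d + 1) * (C * (d + 1) ^ p)) * (K * (C * (d + 1) ^ p)))
        ≤ (d + 1) * (((d + 1) * (C * (d + 1) ^ p)) * (K * (C * (d + 1) ^ p))) := by
      gcongr
      omega
    have h5 : (d + 1) * (((d + 1) * (C * (d + 1) ^ p)) * (K * (C * (d + 1) ^ p)))
        = C * C * K * (d + 1) ^ (2 * p + 2) := by ring
    have := hC d i j
    rw [add_mul]
    linarith

theorem aux_diag {m : ℕ} (M : Matrix (Fin m) (Fin m) ℕ) (l : Fin m) (k : ℕ) :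
    (M l l) ^ k ≤ (M ^ k) l l := by
  induction k with
  | zero => simp
  | succ k ih =>
    rw [pow_succ, pow_succ, Matrix.mul_apply]
    exact (Nat.mul_le_mul_right _ ih).trans
      (Finset.single_le_sum (f := fun j => (M ^ k) l j * M j l) (fun _ _ => Nat.zero_le _)
        (Finset.mem_univ l))

/-- Landscape of the growth rate of matrix powers (Theorem 3.9,
polynomial/exponential dichotomy). -/
theorem matrix_power_growth_dichotomy
    (m : ℕ) (hm : 1 ≤ m) (M : Matrix (Fin m) (Fin m) ℕ) :
    (∃ C p : ℕ, ∀ d : ℕ, 1 ≤ d → ∀ l l' : Fin m, (M ^ d) l l' ≤ C * d ^ p) ∨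
    (∃ β : ℝ, 0 < β ∧
      {d : ℕ | ∃ l l' : Fin m, (1 + β) ^ d ≤ (((M ^ d) l l' : ℕ) : ℝ)}.Infinite) := by
  by_cases h : ∀ d i, (M ^ d) i i ≤ 1
  · left
    obtain ⟨C, p, hC⟩ := aux_poly Finset.univ M (by simp) h
    refine ⟨C * 2 ^ p, p, fun d hd l l' => (hC d l l').trans ?_⟩
    rw [mul_assoc, ← mul_pow]
    gcongr
    omega
  · right
    push Not at h
    obtain ⟨d, l, hl⟩ := h
    have hd : d ≠ 0 := by
      rintro rfl
      simp at hl
    have hdpos : (0 : ℝ) < d := by positivity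
    refine ⟨(2 : ℝ) ^ ((d : ℝ)⁻¹) - 1, ?_, ?_⟩
    · have := Real.one_lt_rpow (x := 2) (z := (d : ℝ)⁻¹) (by norm_num) (by positivity)
      linarith
    · refine Set.infinite_of_injective_forall_mem (f := fun k : ℕ => d * k) ?_ ?_
      · intro a b hab
        exact Nat.eq_of_mul_eq_mul_left (Nat.pos_of_ne_zero hd) hab
      · intro k
        refine ⟨l, l, ?_⟩
        rw [add_sub_cancel, pow_mul, Real.rpow_inv_natCast_pow (by norm_num) hd, pow_mul]
        have : 2 ^ k ≤ ((M ^ d) ^ k) l l :=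
          (Nat.pow_le_pow_left hl k).trans (aux_diag (M ^ d) l k)
        exact_mod_cast this
end

section
/- Row version of the growth dichotomy (used for Corollary 3.10): For every m ≥ 1, every matrix M : Matrix (Fin m) (Fin m) ℕ, and every index l₀ : Fin m, at least one of the following holds: (a) there exist constants C and p : ℕ such that for all d ≥ 1 and all l : Fin m, (M^d) l₀ l ≤ C * d^p; or (b) there exists a real β > 0 such that the set of natural numbers d for which some l : Fin m satisfies (1 + β)^d ≤ (M^d) l₀ l (as real numbers) is infinite. -/
def GRch {m : ℕ} (M : Matrix (Fin m) (Fin m) ℕ) (i j : Fin m) : Prop := ∃ a : ℕ, 0 < (M ^ a) i j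

def GGood {m : ℕ} (M : Matrix (Fin m) (Fin m) ℕ) (l : Fin m) : Prop :=
  ∀ i, GRch M l i → ∀ k, 1 ≤ k → (M ^ k) i i ≤ 1

lemma gmul_le {m : ℕ} (M : Matrix (Fin m) (Fin m) ℕ) (a b : ℕ) (i j k : Fin m) :
    (M ^ a) i j * (M ^ b) j k ≤ (M ^ (a + b)) i k := by
  rw [pow_add, Matrix.mul_apply]
  exact Finset.single_le_sum (f := fun j => (M ^ a) i j * (M ^ b) j k)
    (fun _ _ => Nat.zero_le _) (Finset.mem_univ j)

lemma GRch.refl {m : ℕ} (M : Matrix (Fin m) (Fin m) ℕ) (i : Fin m) : GRch M i i :=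
  ⟨0, by simp⟩

lemma GRch.trans {m : ℕ} {M : Matrix (Fin m) (Fin m) ℕ} {i j k : Fin m}
    (h : GRch M i j) (h' : GRch M j k) : GRch M i k := by
  obtain ⟨a, ha⟩ := h
  obtain ⟨b, hb⟩ := h'
  exact ⟨a + b, lt_of_lt_of_le (Nat.mul_pos ha hb) (gmul_le M a b i j k)⟩

lemma GGood.trans {m : ℕ} {M : Matrix (Fin m) (Fin m) ℕ} {i j : Fin m}
    (h : GGood M i) (h' : GRch M i j) : GGood M j :=
  fun k hk => h k (h'.trans hk)

lemma ggood_le_one {m : ℕ} {M : Matrix (Fin m) (Fin m) ℕ} {l i : Fin m}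
    (h : GGood M l) (h' : GRch M i l) (d : ℕ) : (M ^ d) l i ≤ 1 := by
  rcases Nat.eq_zero_or_pos d with rfl | hd
  · simp only [pow_zero, Matrix.one_apply]
    split_ifs <;> simp
  · obtain ⟨b, hb⟩ := h'
    calc (M ^ d) l i ≤ (M ^ d) l i * (M ^ b) i l := Nat.le_mul_of_pos_right _ hb
      _ ≤ (M ^ (d + b)) l l := gmul_le ..
      _ ≤ 1 := h l (GRch.refl M l) _ (by omega)

open Classical in
lemma gstep {m : ℕ} (M : Matrix (Fin m) (Fin m) ℕ) (l j : Fin m) (hg : GGood M l) (d B : ℕ)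
    (hB : ∀ i', GRch M l i' → ¬ GRch M i' l → ∀ e ≤ d, (M ^ e) i' j ≤ B) (t : ℕ) (ht : t ≤ d) :
    (M ^ d) l j ≤ (∑ i with GRch M l i ∧ GRch M i l, (M ^ t) l i * (M ^ (d - t)) i j)
      + t * ((∑ i, ∑ i', M i i') * B) := by
  induction t with
  | zero =>
    refine le_trans ?_ (Nat.le_add_right _ _)
    refine le_trans ?_ (Finset.single_le_sum
      (f := fun i => (M ^ 0) l i * (M ^ (d - 0)) i j) (fun _ _ => Nat.zero_le _)
      (Finset.mem_filter.2 ⟨Finset.mem_univ l, GRch.refl M l, GRch.refl M l⟩))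
    simp
  | succ t ih =>
    refine (ih (by omega)).trans ?_
    obtain ⟨e, rfl⟩ : ∃ e, d = t + 1 + e := ⟨d - (t + 1), by omega⟩
    have e1 : t + 1 + e - t = 1 + e := by omega
    have e2 : t + 1 + e - (t + 1) = e := by omega
    rw [e1, e2, add_mul t 1, one_mul, add_comm (t * _), ← add_assoc]
    refine Nat.add_le_add_right ?_ _
    have key : ∀ i, GRch M l i ∧ GRch M i l → (M ^ t) l i * (M ^ (1 + e)) i j ≤
        (∑ i' with GRch M l i' ∧ GRch M i' l, (M ^ t) l i * M i i' * (M ^ e) i' j)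
          + (∑ i', M i i') * B := by
      intro i hi
      rw [pow_add, pow_one, Matrix.mul_apply, Finset.mul_sum, Finset.sum_filter, Finset.sum_mul,
        ← Finset.sum_add_distrib]
      refine Finset.sum_le_sum fun i' _ => ?_
      split_ifs with h
      · rw [mul_assoc]; exact Nat.le_add_right _ _
      · rw [zero_add]
        rcases Nat.eq_zero_or_pos (M i i') with h0 | h0
        · simp [h0]
        · have hr : GRch M l i' := hi.1.trans ⟨1, by simpa using h0⟩
          have hn : ¬ GRch M i' l := fun h' => h ⟨hr, h'⟩
          calc (M ^ t) l i * (M i i' * (M ^ e) i' j) ≤ 1 * (M i i' * B) :=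
                Nat.mul_le_mul (ggood_le_one hg hi.2 t)
                  (Nat.mul_le_mul_left _ (hB i' hr hn e (by omega)))
            _ = _ := one_mul _
    calc _ ≤ ∑ i with GRch M l i ∧ GRch M i l,
          ((∑ i' with GRch M l i' ∧ GRch M i' l, (M ^ t) l i * M i i' * (M ^ e) i' j)
          + (∑ i', M i i') * B) :=
            Finset.sum_le_sum fun i hi => key i (Finset.mem_filter.1 hi).2
      _ ≤ _ := by
        rw [Finset.sum_add_distrib]
        refine Nat.add_le_add ?_ ?_
        · rw [Finset.sum_comm]
          refine Finset.sum_le_sum fun i' _ => ?_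
          rw [← Finset.sum_mul, pow_succ, Matrix.mul_apply]
          exact Nat.mul_le_mul_right _
            (Finset.sum_le_sum_of_subset (Finset.filter_subset _ _))
        · rw [← Finset.sum_mul]
          exact Nat.mul_le_mul_right _
            (Finset.sum_le_sum_of_subset (Finset.filter_subset _ _))

open Classical in
lemma gpoly {m : ℕ} (M : Matrix (Fin m) (Fin m) ℕ) (n : ℕ) : ∃ C p : ℕ, ∀ l, GGood M l →
    (Finset.univ.filter (GRch M l)).card ≤ n → ∀ d j, (M ^ d) l j ≤ C * (d + 1) ^ p := by
  induction n with
  | zero =>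
    refine ⟨0, 0, fun l _ h => ?_⟩
    have : l ∈ Finset.univ.filter (GRch M l) := by simp [GRch.refl]
    have := Finset.card_pos.2 ⟨l, this⟩
    omega
  | succ n ih =>
    obtain ⟨C, p, ih⟩ := ih
    refine ⟨m + (∑ i, ∑ i', M i i') * C, p + 1, fun l hg hc d j => ?_⟩
    have h := gstep M l j hg d (C * (d + 1) ^ p) (fun i' hr hn e he => by
      have hss : Finset.univ.filter (GRch M i') ⊂ Finset.univ.filter (GRch M l) := by
        refine Finset.ssubset_iff_subset_ne.2 ⟨?_, ?_⟩
        · intro x hx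
          simp only [Finset.mem_filter, Finset.mem_univ, true_and] at hx ⊢
          exact hr.trans hx
        · intro heq
          have : l ∈ Finset.univ.filter (GRch M l) := by simp [GRch.refl]
          rw [← heq] at this
          exact hn (Finset.mem_filter.1 this).2
      have := Finset.card_lt_card hss
      refine (ih i' (hg.trans hr) (by omega) e j).trans ?_
      gcongr) d le_rfl
    refine h.trans ?_
    have h1 : (∑ i with GRch M l i ∧ GRch M i l, (M ^ d) l i * (M ^ (d - d)) i j) ≤ m := by
      calc _ ≤ ∑ i with GRch M l i ∧ GRch M i l, 1 := by
            refine Finset.sum_le_sum fun i hi => ?_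
            have a1 := ggood_le_one hg (Finset.mem_filter.1 hi).2.2 d
            have a2 : (M ^ (d - d)) i j ≤ 1 := by
              simp only [Nat.sub_self, pow_zero, Matrix.one_apply]
              split_ifs <;> simp
            exact Nat.mul_le_mul a1 a2
        _ ≤ ∑ i : Fin m, 1 := Finset.sum_le_sum_of_subset (Finset.filter_subset _ _)
        _ = m := by simp
    rw [add_mul]
    refine Nat.add_le_add (h1.trans (Nat.le_mul_of_pos_right _ (by positivity))) ?_
    calc d * ((∑ i, ∑ i', M i i') * (C * (d + 1) ^ p))
        ≤ (d + 1) * ((∑ i, ∑ i', M i i') * (C * (d + 1) ^ p)) := by gcongr; omega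
      _ = _ := by ring

/-- Row version of the growth dichotomy (used for Corollary 3.10). -/
theorem matrix_power_row_growth_dichotomy
    (m : ℕ) (hm : 1 ≤ m) (M : Matrix (Fin m) (Fin m) ℕ) (l₀ : Fin m) :
    (∃ C p : ℕ, ∀ d : ℕ, 1 ≤ d → ∀ l : Fin m, (M ^ d) l₀ l ≤ C * d ^ p) ∨
    (∃ β : ℝ, 0 < β ∧
      {d : ℕ | ∃ l : Fin m, (1 + β) ^ d ≤ (((M ^ d) l₀ l : ℕ) : ℝ)}.Infinite) := by
  classical
  by_cases hg : GGood M l₀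
  · left
    obtain ⟨C, p, h⟩ := gpoly M m
    refine ⟨C * 2 ^ p, p, fun d hd l => ?_⟩
    refine (h l₀ hg ((Finset.card_le_univ _).trans (by simp)) d l).trans ?_
    rw [mul_assoc, ← mul_pow]
    gcongr
    omega
  · right
    unfold GGood at hg
    push Not at hg
    obtain ⟨i, ⟨a, ha⟩, k, hk, h2⟩ := hg
    have hpow : ∀ n, 2 ^ n ≤ (M ^ (k * n)) i i := by
      intro n
      induction n with
      | zero => simp
      | succ n ih =>
        calc 2 ^ (n + 1) = 2 ^ n * 2 := pow_succ _ _
          _ ≤ (M ^ (k * n)) i i * (M ^ k) i i := Nat.mul_le_mul ih h2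
          _ ≤ _ := gmul_le ..
    have hs : (a + k : ℕ) ≠ 0 := by omega
    set x : ℝ := (2 : ℝ) ^ (((a + k : ℕ) : ℝ)⁻¹) with hx
    have hx1 : 1 < x := Real.one_lt_rpow (by norm_num) (by positivity)
    have hxp : x ^ (a + k) = 2 := Real.rpow_inv_natCast_pow (by norm_num) hs
    refine ⟨x - 1, by linarith, ?_⟩
    refine Set.infinite_of_injective_forall_mem (f := fun n : ℕ => a + k * (n + 1)) ?_ ?_
    · intro n n' h
      have h : a + k * (n + 1) = a + k * (n' + 1) := h
      have := Nat.eq_of_mul_eq_mul_left (by omega) (Nat.add_left_cancel h)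
      omega
    · intro n
      refine ⟨i, ?_⟩
      have e : 1 + (x - 1) = x := by ring
      rw [e]
      have hN : 2 ^ (n + 1) ≤ (M ^ (a + k * (n + 1))) l₀ i :=
        calc 2 ^ (n + 1) ≤ (M ^ (k * (n + 1))) i i := hpow _
          _ ≤ (M ^ a) l₀ i * (M ^ (k * (n + 1))) i i := Nat.le_mul_of_pos_left _ ha
          _ ≤ _ := gmul_le ..
      calc x ^ (a + k * (n + 1)) ≤ x ^ ((a + k) * (n + 1)) :=
            pow_le_pow_right₀ hx1.le (by nlinarith [Nat.zero_le (a * n)])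
        _ = 2 ^ (n + 1) := by rw [pow_mul, hxp]
        _ ≤ _ := by exact_mod_cast hN
end

section
/- Exponential growth along a reachable type-2 vertex (Corollary in Section 3.2.3): Let M : Matrix (Fin m) (Fin m) ℕ and l₀, l : Fin m. Suppose there exists d₀ : ℕ with 1 ≤ (M^d₀) l₀ l, and there exists L ≥ 1 with 2 ≤ (M^L) l l. Then there exists a real β > 0 such that the set of natural numbers d with (1 + β)^d ≤ (M^d) l₀ l (as real numbers) is infinite. -/
/-- Exponential growth along a reachable type-2 vertex
(Corollary in Section 3.2.3). -/
theorem matrix_power_reachable_exponential_growth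
    (m : ℕ) (M : Matrix (Fin m) (Fin m) ℕ) (l₀ l : Fin m)
    (hreach : ∃ d₀ : ℕ, 1 ≤ (M ^ d₀) l₀ l)
    (htype2 : ∃ L : ℕ, 1 ≤ L ∧ 2 ≤ (M ^ L) l l) :
    ∃ β : ℝ, 0 < β ∧
      {d : ℕ | (1 + β) ^ d ≤ (((M ^ d) l₀ l : ℕ) : ℝ)}.Infinite := by
  obtain ⟨d₀, hd⟩ := hreach
  obtain ⟨L, hL, h2⟩ := htype2
  have key : ∀ (A B : Matrix (Fin m) (Fin m) ℕ) (i j k : Fin m),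
      A i j * B j k ≤ (A * B) i k := by
    intro A B i j k
    rw [Matrix.mul_apply]
    exact Finset.single_le_sum (f := fun x => A i x * B x k)
      (fun _ _ => Nat.zero_le _) (Finset.mem_univ j)
  have hk : ∀ k : ℕ, 2 ^ k ≤ (M ^ (d₀ + L * k)) l₀ l := by
    intro k
    induction k with
    | zero => simpa using hd
    | succ k ih =>
      have h := key (M ^ (d₀ + L * k)) (M ^ L) l₀ l l
      rw [← pow_add] at h
      rw [show d₀ + L * (k + 1) = d₀ + L * k + L by ring, pow_succ]
      exact (Nat.mul_le_mul ih h2).trans h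
  have hN : d₀ + L ≠ 0 := by omega
  set c : ℝ := (2 : ℝ) ^ (((d₀ + L : ℕ) : ℝ)⁻¹) with hc
  have hcN : c ^ (d₀ + L) = 2 := Real.rpow_inv_natCast_pow (by norm_num) hN
  have hc1 : 1 < c := Real.one_lt_rpow (by norm_num) (by positivity)
  refine ⟨c - 1, by linarith, ?_⟩
  refine Set.infinite_of_injective_forall_mem (f := fun k : ℕ => d₀ + L * (k + 1)) ?_ ?_
  · intro a b hab
    have h : L * (a + 1) = L * (b + 1) := Nat.add_left_cancel hab
    have := Nat.eq_of_mul_eq_mul_left hL h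
    omega
  · intro k
    show (1 + (c - 1)) ^ (d₀ + L * (k + 1)) ≤ _
    rw [add_sub_cancel]
    calc c ^ (d₀ + L * (k + 1)) ≤ c ^ ((d₀ + L) * (k + 1)) :=
          pow_le_pow_right₀ hc1.le (by nlinarith [Nat.zero_le (d₀ * k)])
      _ = 2 ^ (k + 1) := by rw [pow_mul, hcN]
      _ ≤ _ := by exact_mod_cast hk (k + 1)
end

section
/- Polynomial growth in the absence of reachable type-2 vertices (Lemma in Section 3.2.3): Let M : Matrix (Fin m) (Fin m) ℕ and l₀ : Fin m. Suppose that for every l : Fin m that is reachable from l₀ (i.e., such that there exists d : ℕ with 1 ≤ (M^d) l₀ l) and for every d ≥ 1 one has (M^d) l l ≤ 1. Then there exists a constant C : ℕ such that for all d ≥ 1 and all l : Fin m, (M^d) l₀ l ≤ C * d^m. -/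
/-- `M` with column `l` erased. -/
def eraseCol {m : ℕ} (M : Matrix (Fin m) (Fin m) ℕ) (l : Fin m) : Matrix (Fin m) (Fin m) ℕ :=
  Matrix.of fun i j => if j = l then 0 else M i j

lemma eraseCol_le {m : ℕ} (M : Matrix (Fin m) (Fin m) ℕ) (l : Fin m) (d : ℕ) (i j : Fin m) :
    ((eraseCol M l) ^ d) i j ≤ (M ^ d) i j := by
  induction d generalizing j with
  | zero => simp
  | succ d ih =>
    rw [pow_succ, pow_succ, Matrix.mul_apply, Matrix.mul_apply]
    refine Finset.sum_le_sum fun k _ => Nat.mul_le_mul (ih k) ?_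
    simp only [eraseCol, Matrix.of_apply]
    split_ifs <;> simp

lemma decomp_le {m : ℕ} (M : Matrix (Fin m) (Fin m) ℕ) (l : Fin m) (d : ℕ) (j : Fin m) :
    (M ^ d) l j ≤ ∑ k ∈ Finset.range (d + 1), (M ^ k) l l * ((eraseCol M l) ^ (d - k)) l j := by
  induction d generalizing j with
  | zero => simp
  | succ d ih =>
    by_cases hj : j = l
    · subst hj
      rw [Finset.sum_range_succ]
      simp
    · rw [Finset.sum_range_succ, pow_succ, Matrix.mul_apply]
      refine le_trans ?_ (Nat.le_add_right _ _)
      calc ∑ i, (M ^ d) l i * M i j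
          ≤ ∑ i, (∑ k ∈ Finset.range (d + 1),
              (M ^ k) l l * ((eraseCol M l) ^ (d - k)) l i) * eraseCol M l i j := by
            refine Finset.sum_le_sum fun i _ => Nat.mul_le_mul (ih i) ?_
            simp [eraseCol, hj]
        _ = _ := by
            simp_rw [Finset.sum_mul]
            rw [Finset.sum_comm]
            refine Finset.sum_congr rfl fun k hk => ?_
            have : d + 1 - k = (d - k) + 1 := by
              have := Finset.mem_range.1 hk
              omega
            rw [this, pow_succ _ (d - k), Matrix.mul_apply, Finset.mul_sum]
            simp_rw [mul_assoc]

lemma growth_aux {m : ℕ} (n : ℕ) : ∀ (S : Finset (Fin m)), S.card = n →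
    ∀ (M : Matrix (Fin m) (Fin m) ℕ), (∀ i j, j ∉ S → M i j = 0) → ∀ l₀ : Fin m,
    (∀ l : Fin m, (∃ d : ℕ, 1 ≤ (M ^ d) l₀ l) → ∀ d : ℕ, 1 ≤ d → (M ^ d) l l ≤ 1) →
    ∃ C : ℕ, ∀ d : ℕ, ∀ l : Fin m, (M ^ d) l₀ l ≤ C * (d + 1) ^ n := by
  induction n with
  | zero =>
    intro S hS M hM l₀ _
    have hS : S = ∅ := Finset.card_eq_zero.1 hS
    have hM0 : M = 0 := by
      ext i j
      exact hM i j (by simp [hS])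
    refine ⟨1, fun d l => ?_⟩
    rcases d with _ | d
    · simp only [pow_zero, Matrix.one_apply]
      split_ifs <;> simp
    · simp [hM0]
  | succ n ih =>
    intro S hS M hM
    have key : ∀ l₀ ∈ S,
        (∀ l : Fin m, (∃ d : ℕ, 1 ≤ (M ^ d) l₀ l) → ∀ d : ℕ, 1 ≤ d → (M ^ d) l l ≤ 1) →
        ∃ C : ℕ, ∀ d : ℕ, ∀ l : Fin m, (M ^ d) l₀ l ≤ C * (d + 1) ^ (n + 1) := by
      intro l₀ hl h
      obtain ⟨C, hC⟩ := ih (S.erase l₀) (by rw [Finset.card_erase_of_mem hl, hS]; rfl)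
        (eraseCol M l₀) (by
          intro i j hj
          simp only [eraseCol, Matrix.of_apply]
          split_ifs with hjl
          · rfl
          · exact hM i j fun h' => hj (Finset.mem_erase.2 ⟨hjl, h'⟩)) l₀ (by
          rintro l ⟨d, hd⟩ e he
          exact (eraseCol_le M l₀ e l l).trans
            (h l ⟨d, hd.trans (eraseCol_le M l₀ d l₀ l)⟩ e he))
      refine ⟨C, fun d l => (decomp_le M l₀ d l).trans ?_⟩
      calc _ ≤ ∑ k ∈ Finset.range (d + 1), C * (d + 1) ^ n := by
            refine Finset.sum_le_sum fun k hk => ?_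
            have h1 : (M ^ k) l₀ l₀ ≤ 1 := by
              rcases k with _ | k
              · simp
              · exact h l₀ ⟨0, by simp⟩ _ (by omega)
            have h2 : C * (d - k + 1) ^ n ≤ C * (d + 1) ^ n :=
              Nat.mul_le_mul_left _ (Nat.pow_le_pow_left (by omega) _)
            calc _ ≤ 1 * (C * (d + 1) ^ n) := Nat.mul_le_mul h1 ((hC _ _).trans h2)
              _ = _ := one_mul _
        _ = _ := by simp; ring
    intro l₀ h
    have h1 : ∀ i, ∃ C : ℕ, ∀ d : ℕ, ∀ l : Fin m,
        M l₀ i * (M ^ d) i l ≤ C * (d + 1) ^ (n + 1) := by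
      intro i
      by_cases h0 : M l₀ i = 0
      · exact ⟨0, by simp [h0]⟩
      · have hi : i ∈ S := by
          by_contra hi
          exact h0 (hM _ _ hi)
        obtain ⟨C, hC⟩ := key i hi (by
          rintro l ⟨d, hd⟩
          refine h l ⟨d + 1, ?_⟩
          rw [pow_succ', Matrix.mul_apply]
          calc 1 ≤ M l₀ i * (M ^ d) i l := Nat.mul_pos (Nat.pos_of_ne_zero h0) hd
            _ ≤ _ := Finset.single_le_sum (f := fun i => M l₀ i * (M ^ d) i l)
              (fun _ _ => Nat.zero_le _) (Finset.mem_univ i))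
        refine ⟨M l₀ i * C, fun d l => ?_⟩
        rw [mul_assoc]
        exact Nat.mul_le_mul_left _ (hC d l)
    choose C hC using h1
    refine ⟨1 + ∑ i, C i, fun d l => ?_⟩
    rcases d with _ | d
    · simp only [pow_zero, Matrix.one_apply]
      split_ifs <;> simp
    · rw [pow_succ', Matrix.mul_apply]
      calc _ ≤ ∑ i, C i * (d + 1) ^ (n + 1) := Finset.sum_le_sum fun i _ => hC i d l
        _ = (∑ i, C i) * (d + 1) ^ (n + 1) := by rw [Finset.sum_mul]
        _ ≤ _ := Nat.mul_le_mul (by omega) (Nat.pow_le_pow_left (by omega) _)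

/-- Polynomial growth in the absence of reachable type-2 vertices
(Lemma in Section 3.2.3). -/
theorem matrix_power_polynomial_growth_no_type2
    (m : ℕ) (M : Matrix (Fin m) (Fin m) ℕ) (l₀ : Fin m)
    (hno2 : ∀ l : Fin m, (∃ d : ℕ, 1 ≤ (M ^ d) l₀ l) →
      ∀ d : ℕ, 1 ≤ d → (M ^ d) l l ≤ 1) :
    ∃ C : ℕ, ∀ d : ℕ, 1 ≤ d → ∀ l : Fin m, (M ^ d) l₀ l ≤ C * d ^ m := by
  obtain ⟨C, hC⟩ := growth_aux m Finset.univ (by simp) M (by simp) l₀ hno2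
  refine ⟨C * 2 ^ m, fun d hd l => (hC d l).trans ?_⟩
  rw [mul_assoc, ← mul_pow]
  exact Nat.mul_le_mul_left _ (Nat.pow_le_pow_left (by omega) _)
end

section
/- Exact optimal mending volume of the polynomial propagation problem (Problem 4, Section 3.4): Let p, q : ℕ with 1 ≤ p < q and set Δ = 2^q. Call a labeling f : List (Fin Δ) → Bool of the infinite Δ-regular rooted tree valid if f [] = true and for every vertex v with f v = true, at least 2^p of the children v ++ [i] (i : Fin Δ) satisfy f (v ++ [i]) = true. Then: (a) for every valid f and every D : ℕ, the number of vertices v with v.length ≤ D and f v = true is at least ∑_{d=0}^{D} (2^p)^d; and (b) there exists a valid f such that for every D : ℕ, the number of vertices v with v.length ≤ D and f v = true equals ∑_{d=0}^{D} (2^p)^d. -/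
def ppLev {n : ℕ} (f : List (Fin n) → Bool) : ℕ → Finset (List (Fin n))
  | 0 => {[]}
  | d + 1 => (ppLev f d).biUnion fun v =>
      (Finset.univ.filter (fun i : Fin n => f (v ++ [i]) = true)).image (fun i => v ++ [i])

theorem ppLev_mem {n : ℕ} (f : List (Fin n) → Bool) (h0 : f [] = true) (d : ℕ) :
    ∀ v ∈ ppLev f d, v.length = d ∧ f v = true := by
  induction d with
  | zero => intro v hv; simp [ppLev] at hv; simp [hv, h0]
  | succ d ih =>
    intro v hv
    simp only [ppLev, Finset.mem_biUnion, Finset.mem_image, Finset.mem_filter] at hv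
    obtain ⟨u, hu, i, ⟨_, hi⟩, rfl⟩ := hv
    exact ⟨by simp [(ih u hu).1], hi⟩

theorem ppLev_card_succ {n : ℕ} (f : List (Fin n) → Bool) (d : ℕ) :
    (ppLev f (d + 1)).card = ∑ v ∈ ppLev f d,
      (Finset.univ.filter (fun i : Fin n => f (v ++ [i]) = true)).card := by
  rw [ppLev, Finset.card_biUnion]
  · refine Finset.sum_congr rfl fun v _ => ?_
    exact Finset.card_image_of_injective _ (fun a b h => by simpa using h)
  · intro u _ v _ huv
    rw [Function.onFun_apply, Finset.disjoint_left]
    intro w h1 h2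
    simp only [Finset.mem_image] at h1 h2
    obtain ⟨i, _, rfl⟩ := h1
    obtain ⟨j, _, h⟩ := h2
    exact huv (List.append_inj' h rfl).1.symm

theorem ppLev_union_card {n : ℕ} (f : List (Fin n) → Bool) (h0 : f [] = true) (D : ℕ) :
    ((Finset.range (D + 1)).biUnion (ppLev f)).card
      = ∑ d ∈ Finset.range (D + 1), (ppLev f d).card := by
  apply Finset.card_biUnion
  intro a _ b _ hab
  rw [Function.onFun_apply, Finset.disjoint_left]
  intro w h1 h2
  exact hab ((ppLev_mem f h0 a w h1).1.symm.trans (ppLev_mem f h0 b w h2).1)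

theorem ppLev_lower {n : ℕ} (f : List (Fin n) → Bool) (h0 : f [] = true) (K : ℕ)
    (h : ∀ v, f v = true → K ≤ (Finset.univ.filter
      (fun i : Fin n => f (v ++ [i]) = true)).card) (d : ℕ) : K ^ d ≤ (ppLev f d).card := by
  induction d with
  | zero => simp [ppLev]
  | succ d ih =>
    rw [ppLev_card_succ, pow_succ]
    calc K ^ d * K ≤ (ppLev f d).card * K := Nat.mul_le_mul_right _ ih
      _ = ∑ v ∈ ppLev f d, K := by simp
      _ ≤ _ := Finset.sum_le_sum fun v hv => h v (ppLev_mem f h0 d v hv).2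

theorem ppLev_eq {n : ℕ} (f : List (Fin n) → Bool) (h0 : f [] = true) (K : ℕ)
    (h : ∀ v, f v = true → (Finset.univ.filter
      (fun i : Fin n => f (v ++ [i]) = true)).card = K) (d : ℕ) : (ppLev f d).card = K ^ d := by
  induction d with
  | zero => simp [ppLev]
  | succ d ih =>
    rw [ppLev_card_succ, pow_succ, ← ih,
      Finset.sum_congr rfl fun v hv => h v (ppLev_mem f h0 d v hv).2]
    simp

theorem ppLev_complete {n : ℕ} (f : List (Fin n) → Bool)
    (hc : ∀ v i, f (v ++ [i]) = true → f v = true) (v : List (Fin n)) :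
    f v = true → v ∈ ppLev f v.length := by
  induction v using List.reverseRecOn with
  | nil => simp [ppLev]
  | append_singleton v i ih =>
    intro h
    rw [List.length_append, List.length_singleton, ppLev]
    simp only [Finset.mem_biUnion, Finset.mem_image, Finset.mem_filter]
    exact ⟨v, ih (hc v i h), i, ⟨Finset.mem_univ _, h⟩, rfl⟩


/-- Exact optimal mending volume of the polynomial propagation problem
(Problem 4, Section 3.4). -/
theorem polynomial_propagation_optimal_volume
    (p q : ℕ) (hp : 1 ≤ p) (hpq : p < q) :
    ((∀ f : List (Fin (2 ^ q)) → Bool,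
        (f [] = true ∧
          ∀ v : List (Fin (2 ^ q)), f v = true →
            2 ^ p ≤ (Finset.univ.filter
              (fun i : Fin (2 ^ q) => f (v ++ [i]) = true)).card) →
        ∀ D : ℕ,
          (∑ d ∈ Finset.range (D + 1), (2 ^ p) ^ d) ≤
            {v : List (Fin (2 ^ q)) | v.length ≤ D ∧ f v = true}.ncard) ∧
      (∃ f : List (Fin (2 ^ q)) → Bool,
        (f [] = true ∧
          ∀ v : List (Fin (2 ^ q)), f v = true →
            2 ^ p ≤ (Finset.univ.filter
              (fun i : Fin (2 ^ q) => f (v ++ [i]) = true)).card) ∧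
        ∀ D : ℕ,
          {v : List (Fin (2 ^ q)) | v.length ≤ D ∧ f v = true}.ncard =
            ∑ d ∈ Finset.range (D + 1), (2 ^ p) ^ d)) := by
  constructor
  · rintro f ⟨h0, h⟩ D
    have hfin : {v : List (Fin (2 ^ q)) | v.length ≤ D ∧ f v = true}.Finite :=
      (List.finite_length_le (Fin (2 ^ q)) D).subset fun v hv => hv.1
    calc _ ≤ ∑ d ∈ Finset.range (D + 1), (ppLev f d).card :=
          Finset.sum_le_sum fun d _ => ppLev_lower f h0 _ h d
      _ = ((Finset.range (D + 1)).biUnion (ppLev f)).card := (ppLev_union_card f h0 D).symm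
      _ = (((Finset.range (D + 1)).biUnion (ppLev f) : Finset _) :
            Set (List (Fin (2 ^ q)))).ncard := (Set.ncard_coe_finset _).symm
      _ ≤ _ := by
        apply Set.ncard_le_ncard _ hfin
        intro v hv
        simp only [Finset.mem_coe, Finset.mem_biUnion, Finset.mem_range] at hv
        obtain ⟨d, hd, hv⟩ := hv
        have := ppLev_mem f h0 d v hv
        exact ⟨by omega, this.2⟩
  · let f : List (Fin (2 ^ q)) → Bool := fun v => v.all fun i => decide (i.val < 2 ^ p)
    have h0 : f [] = true := rfl
    have hle : 2 ^ p ≤ 2 ^ q := Nat.pow_le_pow_right (by norm_num) hpq.le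
    have happ : ∀ v i, f (v ++ [i]) = true ↔ f v = true ∧ i.val < 2 ^ p := by
      intro v i
      simp only [f, List.all_append, Bool.and_eq_true, List.all_cons, List.all_nil,
        decide_eq_true_eq, and_true]
    have h : ∀ v, f v = true → (Finset.univ.filter
        (fun i : Fin (2 ^ q) => f (v ++ [i]) = true)).card = 2 ^ p := by
      intro v hv
      simp only [happ, hv, true_and]
      rw [Fin.card_filter_val_lt]
      exact min_eq_right hle
    refine ⟨f, ⟨h0, fun v hv => (h v hv).ge⟩, fun D => ?_⟩
    rw [← Finset.sum_congr rfl fun d _ => ppLev_eq f h0 _ h d, ← ppLev_union_card f h0 D,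
      ← Set.ncard_coe_finset]
    congr 1
    ext v
    simp only [Finset.mem_coe, Finset.mem_biUnion, Finset.mem_range, Set.mem_setOf_eq]
    constructor
    · rintro ⟨hl, hv⟩
      exact ⟨v.length, by omega, ppLev_complete f (fun v i h => ((happ v i).1 h).1) v hv⟩
    · rintro ⟨d, hd, hv⟩
      have := ppLev_mem f h0 d v hv
      exact ⟨by omega, this.2⟩
end

section
/- Local patching lemma (hybrid argument of Section 4.2): Let G be a simple graph on a vertex type V, let r : ℕ, let Σ be a type of labels, and let Q assign to each vertex v : V a predicate Q v on labelings λ : V → Σ that is r-local: whenever two labelings agree on every vertex at graph distance at most r from v, Q v holds for one iff it holds for the other. Let λ, λ' : V → Σ satisfy Q u λ and Q u λ' for every u : V, let D = {u | λ u ≠ λ' u}, and let D' ⊆ D be such that no vertex u : V is simultaneously within graph distance r of some element of D' and within graph distance r of some element of D \ D'. Define λ'' : V → Σ by λ'' u = λ u for u ∈ D' and λ'' u = λ' u otherwise. Then Q u λ'' holds for every u : V. -/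
/-- Local patching lemma (hybrid argument of Section 4.2). -/
theorem local_patching
    {V : Type*} (G : SimpleGraph V) (r : ℕ) (Lab : Type*)
    (Q : V → (V → Lab) → Prop)
    (hQlocal : ∀ (v : V) (lam₁ lam₂ : V → Lab),
      (∀ u : V, (∃ w : G.Walk v u, w.length ≤ r) → lam₁ u = lam₂ u) →
      (Q v lam₁ ↔ Q v lam₂))
    (lam lam' : V → Lab)
    (hlam : ∀ u : V, Q u lam) (hlam' : ∀ u : V, Q u lam')
    (D : Set V) (hD : D = {u : V | lam u ≠ lam' u})
    (D' : Set V) (hD' : D' ⊆ D)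
    (hsep : ∀ u : V,
      ¬((∃ a ∈ D', ∃ w : G.Walk a u, w.length ≤ r) ∧
        (∃ a ∈ D \ D', ∃ w : G.Walk a u, w.length ≤ r)))
    (lam'' : V → Lab)
    (hin : ∀ u ∈ D', lam'' u = lam u)
    (hout : ∀ u ∉ D', lam'' u = lam' u) :
    ∀ u : V, Q u lam'' := by
  intro v
  by_cases h : ∃ a ∈ D', ∃ w : G.Walk a v, w.length ≤ r
  · refine (hQlocal v lam'' lam ?_).2 (hlam v)
    rintro u ⟨w, hw⟩
    by_cases hu : u ∈ D'
    · exact hin u hu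
    · rw [hout u hu]
      by_contra hne
      refine hsep v ⟨h, u, ⟨?_, hu⟩, w.reverse, by simpa using hw⟩
      rw [hD]
      exact fun e => hne e.symm
  · refine (hQlocal v lam'' lam' ?_).2 (hlam' v)
    rintro u ⟨w, hw⟩
    refine hout u (fun hu => h ⟨u, hu, w.reverse, by simpa using hw⟩)
end

section
/- Connectivity of the relabeled set of a minimal mend (Section 4.2): Let G be a simple graph on a finite vertex type V, let r : ℕ, let Σ be a type, and let Q assign to each vertex an r-local predicate on partial labelings λ : V → Option Σ. Let λ : V → Option Σ satisfy Q u λ for all u, let v : V with λ v = none, and call μ : V → Option Σ a mend of λ at v if Q u μ holds for all u and dom λ ∪ {v} ⊆ dom μ, where dom λ = {u | λ u ≠ none}. Suppose a mend of λ at v exists, and let λ' be a mend of λ at v that minimizes the cardinality of D = {u | λ u ≠ λ' u} among all mends of λ at v. Then the set N_r(D) = {u | some element of D is within graph distance r of u} induces a connected subgraph of G. -/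
/-- Connectivity of the relabeled set of a minimal mend (Section 4.2). -/
theorem minimal_mend_relabeled_set_connected
    {V : Type*} [Fintype V] (G : SimpleGraph V) (r : ℕ) (Lab : Type*)
    (Q : V → (V → Option Lab) → Prop)
    (hQlocal : ∀ (w : V) (lam₁ lam₂ : V → Option Lab),
      (∀ u : V, (∃ p : G.Walk w u, p.length ≤ r) → lam₁ u = lam₂ u) →
      (Q w lam₁ ↔ Q w lam₂))
    (lam : V → Option Lab) (hlam : ∀ u : V, Q u lam)
    (v : V) (hv : lam v = none)
    -- `IsMend μ` : μ is a mend of `lam` at `v`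
    (IsMend : (V → Option Lab) → Prop)
    (hIsMend : ∀ μ : V → Option Lab,
      IsMend μ ↔ ((∀ u : V, Q u μ) ∧
        {u : V | lam u ≠ none} ∪ {v} ⊆ {u : V | μ u ≠ none}))
    (lam' : V → Option Lab) (hmend : IsMend lam')
    (hmin : ∀ μ : V → Option Lab, IsMend μ →
      {u : V | lam u ≠ lam' u}.ncard ≤ {u : V | lam u ≠ μ u}.ncard) :
    ∀ u ∈ {x : V | ∃ a ∈ {u : V | lam u ≠ lam' u}, ∃ p : G.Walk a x, p.length ≤ r},
      ∀ w ∈ {x : V | ∃ a ∈ {u : V | lam u ≠ lam' u}, ∃ p : G.Walk a x, p.length ≤ r},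
        ∃ p : G.Walk u w, ∀ x ∈ p.support,
          x ∈ {x : V | ∃ a ∈ {u : V | lam u ≠ lam' u}, ∃ p : G.Walk a x, p.length ≤ r} := by
  classical
  set N : Set V := {x : V | ∃ a ∈ {u : V | lam u ≠ lam' u}, ∃ p : G.Walk a x, p.length ≤ r} with hN
  have hstay : ∀ a, lam a ≠ lam' a → ∀ x (p : G.Walk a x), p.length ≤ r →
      ∀ y ∈ p.support, y ∈ N := by
    intro a ha x p hp y hy
    exact ⟨a, ha, p.takeUntil y hy, (p.length_takeUntil_le hy).trans hp⟩
  let R : V → Prop := fun u => ∃ p : G.Walk v u, ∀ x ∈ p.support, x ∈ N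
  have hRtrans : ∀ a b (p : G.Walk a b), (∀ x ∈ p.support, x ∈ N) → R a → R b := by
    rintro a b p hp ⟨q, hq⟩
    refine ⟨q.append p, fun x hx => ?_⟩
    rcases (SimpleGraph.Walk.mem_support_append_iff q p).1 hx with h | h
    · exact hq x h
    · exact hp x h
  have hrev : ∀ a b (p : G.Walk a b), (∀ x ∈ p.support, x ∈ N) →
      (∀ x ∈ p.reverse.support, x ∈ N) := by
    intro a b p hp x hx
    rw [SimpleGraph.Walk.support_reverse, List.mem_reverse] at hx
    exact hp x hx
  obtain ⟨hQ', hdom⟩ := (hIsMend lam').1 hmend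
  have hv' : lam' v ≠ none := hdom (Or.inr rfl)
  have hvD : lam v ≠ lam' v := by rw [hv]; exact hv'.symm
  have hRv : R v := ⟨SimpleGraph.Walk.nil,
    hstay v hvD v SimpleGraph.Walk.nil (Nat.zero_le _)⟩
  let μ : V → Option Lab := fun u => if R u then lam' u else lam u
  have hμ : IsMend μ := by
    refine (hIsMend μ).2 ⟨fun w => ?_, ?_⟩
    · by_cases hw : R w
      · refine (hQlocal w μ lam' ?_).2 (hQ' w)
        rintro u ⟨p, hp⟩
        by_cases hu : lam u = lam' u
        · simp [μ, hu]
        · have h1 := hstay u hu w p.reverse (by simpa using hp)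
          have : R u := hRtrans w u p (by simpa using hrev _ _ _ h1) hw
          simp [μ, this]
      · refine (hQlocal w μ lam ?_).2 (hlam w)
        rintro u ⟨p, hp⟩
        by_cases hu : lam u = lam' u
        · simp [μ, hu]
        · have h1 := hstay u hu w p.reverse (by simpa using hp)
          have : ¬ R u := fun h => hw (hRtrans u w _ h1 h)
          simp [μ, this]
    · intro u hu
      have h2 := hdom hu
      change μ u ≠ none
      by_cases hR : R u
      · simpa [μ, hR] using h2
      · rcases hu with hu | hu
        · simpa [μ, hR] using hu
        · rw [Set.mem_singleton_iff] at hu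
          subst hu
          exact absurd hRv hR
  have hsub : {u : V | lam u ≠ μ u} ⊆ {u : V | lam u ≠ lam' u} := by
    intro u hu
    by_cases hR : R u
    · simpa [μ, hR] using hu
    · simp [μ, hR] at hu
  have heq := Set.eq_of_subset_of_ncard_le hsub (hmin μ hμ) (Set.toFinite _)
  have hDR : ∀ a, lam a ≠ lam' a → R a := by
    intro a ha
    by_contra hR
    have : a ∈ {u : V | lam u ≠ μ u} := by rw [heq]; exact ha
    simp [μ, hR] at this
  have hNR : ∀ u ∈ N, R u := by
    rintro u ⟨a, ha, p, hp⟩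
    exact hRtrans a u p (hstay a ha u p hp) (hDR a ha)
  intro u hu w hw
  obtain ⟨p, hp⟩ := hNR u hu
  obtain ⟨q, hq⟩ := hNR w hw
  refine ⟨p.reverse.append q, fun x hx => ?_⟩
  rcases (SimpleGraph.Walk.mem_support_append_iff p.reverse q).1 hx with h | h
  · exact hrev _ _ p hp x h
  · exact hq x h
end

section
/- Distance bound from a connected r-inflation (hierarchy inequality MRad ≤ O(r) · ∃MVol of Section 4.2): Let G be a simple graph on a vertex type V, r : ℕ, and let S be a finite nonempty set of vertices. Suppose the set N_r(S) = {u | some element of S is within graph distance r of u} induces a connected subgraph of G. Then for all u, w ∈ S there exists a walk in G from u to w of length at most (2r + 1) * (|S| - 1), where |S| is the cardinality of S. -/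
/-- Auxiliary graph on S: distinct points joined by a walk of length at most 2r+1. -/
def inflAux {V : Type*} (G : SimpleGraph V) (r : ℕ) (S : Finset V) : SimpleGraph S where
  Adj a b := a ≠ b ∧ ∃ p : G.Walk a.1 b.1, p.length ≤ 2 * r + 1
  symm := ⟨fun a b h => ⟨h.1.symm, by
    obtain ⟨p, hp⟩ := h.2
    exact ⟨p.reverse, by simpa using hp⟩⟩⟩
  loopless := ⟨fun a h => h.1 rfl⟩

theorem inflAux_reach_one {V : Type*} (G : SimpleGraph V) (r : ℕ) (S : Finset V) (a b : S)
    (p : G.Walk a.1 b.1) (hp : p.length ≤ 2 * r + 1) : (inflAux G r S).Reachable a b := by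
  by_cases h : a = b
  · subst h; exact SimpleGraph.Reachable.refl _
  · exact SimpleGraph.Adj.reachable ⟨h, p, hp⟩

theorem inflAux_reach {V : Type*} (G : SimpleGraph V) (r : ℕ) (S : Finset V) {x y : V}
    (p : G.Walk x y) : (∀ z ∈ p.support, ∃ a ∈ S, ∃ q : G.Walk a z, q.length ≤ r) →
    ∀ a b : S, (∃ q : G.Walk a.1 x, q.length ≤ r) → (∃ q : G.Walk b.1 y, q.length ≤ r) →
    (inflAux G r S).Reachable a b := by
  induction p with
  | nil =>
    rintro - a b ⟨q, hq⟩ ⟨q', hq'⟩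
    exact inflAux_reach_one G r S a b (q.append q'.reverse) (by simp; omega)
  | cons h p ih =>
    rintro hs a b ⟨q, hq⟩ hb
    obtain ⟨c, hc, q', hq'⟩ := hs _ (List.mem_cons_of_mem _ p.start_mem_support)
    refine (inflAux_reach_one G r S a ⟨c, hc⟩ (q.append (SimpleGraph.Walk.cons h q'.reverse))
      (by simp; omega)).trans ?_
    exact ih (fun z hz => hs z (List.mem_cons_of_mem _ hz)) ⟨c, hc⟩ b ⟨q', hq'⟩ hb

theorem inflAux_walk {V : Type*} (G : SimpleGraph V) (r : ℕ) (S : Finset V) {a b : S}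
    (p : (inflAux G r S).Walk a b) :
    ∃ q : G.Walk a.1 b.1, q.length ≤ (2 * r + 1) * p.length := by
  induction p with
  | nil => exact ⟨SimpleGraph.Walk.nil, by simp⟩
  | cons h p ih =>
    obtain ⟨q, hq⟩ := ih
    obtain ⟨q', hq'⟩ := h.2
    refine ⟨q'.append q, ?_⟩
    rw [SimpleGraph.Walk.length_append, SimpleGraph.Walk.length_cons, Nat.mul_succ]
    omega

/-- Distance bound from a connected r-inflation
(hierarchy inequality MRad ≤ O(r) · ∃MVol of Section 4.2). -/
theorem distance_bound_from_connected_inflation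
    {V : Type*} (G : SimpleGraph V) (r : ℕ)
    (S : Finset V) (hS : S.Nonempty)
    (hconn : ∀ u ∈ {x : V | ∃ a ∈ S, ∃ p : G.Walk a x, p.length ≤ r},
      ∀ w ∈ {x : V | ∃ a ∈ S, ∃ p : G.Walk a x, p.length ≤ r},
        ∃ p : G.Walk u w, ∀ x ∈ p.support,
          x ∈ {x : V | ∃ a ∈ S, ∃ p : G.Walk a x, p.length ≤ r}) :
    ∀ u ∈ S, ∀ w ∈ S,
      ∃ p : G.Walk u w, p.length ≤ (2 * r + 1) * (S.card - 1) := by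
  intro u hu w hw
  obtain ⟨p, hp⟩ := hconn u ⟨u, hu, SimpleGraph.Walk.nil, by simp⟩
    w ⟨w, hw, SimpleGraph.Walk.nil, by simp⟩
  obtain ⟨t, ht⟩ := (inflAux_reach G r S p hp ⟨u, hu⟩ ⟨w, hw⟩ ⟨SimpleGraph.Walk.nil, by simp⟩
    ⟨SimpleGraph.Walk.nil, by simp⟩).exists_isPath
  obtain ⟨q, hq⟩ := inflAux_walk G r S t
  have hl := ht.length_lt
  rw [Fintype.card_coe] at hl
  exact ⟨q, hq.trans (Nat.mul_le_mul_left _ (by omega))⟩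
end
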